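/- Fix n ∈ ℕ, a positive semidefinite matrix P ∈ ℝⁿˣⁿ, a vector q ∈ ℝⁿ, scalars r ∈ ℝ and α ∈ (0,1), and a positive semidefinite matrix Σ ∈ ℝⁿˣⁿ. Let 𝒫 be the set of probability measures μ on ℝⁿ with finite second moments satisfying ∫ e dμ = 0 and ∫ e eᵀ dμ = Σ, let g(e) = eᵀ P e + 2 qᵀ e + r, and let Ω ∈ ℝ⁽ⁿ⁺¹⁾ˣ⁽ⁿ⁺¹⁾ be the block matrix with blocks Σ (top-left), 0 (off-diagonal) and 1 (bottom-right). Then sup_{μ ∈ 𝒫} CVaR_α^μ(g(e)) = inf { s + α⁻¹ Tr(Ω M) : s ∈ ℝ, M ∈ ℝ⁽ⁿ⁺¹⁾ˣ⁽ⁿ⁺¹⁾ positive semidefinite, and M − [[P, q],[qᵀ, r − s]] positive semidefinite }. -/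

import Mathlib

open MeasureTheory Matrix

/-- The Conditional Value-at-Risk of `Z` at level `α` under the measure `μ`:
`CVaR_α^μ(Z) = inf_{s ∈ ℝ} ( s + α⁻¹ ∫ max(Z − s, 0) dμ )`. -/
noncomputable def cvar {Ω : Type*} [MeasurableSpace Ω]
    (μ : Measure Ω) (α : ℝ) (Z : Ω → ℝ) : ℝ :=
  ⨅ s : ℝ, (s + α⁻¹ * ∫ ω, max (Z ω - s) 0 ∂μ)

/-- The moment-based ambiguity set of probability measures on `ℝⁿ` with finite
second moments, zero mean, and second moment matrix `S`. -/
def momentSet (n : ℕ) (S : Matrix (Fin n) (Fin n) ℝ) :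
    Set (Measure (Fin n → ℝ)) :=
  {μ | IsProbabilityMeasure μ ∧ Integrable (fun e => ‖e‖ ^ 2) μ ∧
    (∫ e, e ∂μ) = 0 ∧ ∀ i j, ∫ e, e i * e j ∂μ = S i j}


structure Mom {n : ℕ} (ν : Measure (Fin n → ℝ)) (m : Fin n → ℝ)
    (Q : Matrix (Fin n) (Fin n) ℝ) : Prop where
  prob : IsProbabilityMeasure ν
  i1 : ∀ i, Integrable (fun e : Fin n → ℝ => e i) ν
  i2 : ∀ i j, Integrable (fun e : Fin n → ℝ => e i * e j) ν
  m1 : ∀ i, ∫ e, e i ∂ν = m i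
  m2 : ∀ i j, ∫ e, e i * e j ∂ν = Q i j

lemma quad_expand {n : ℕ} (A : Matrix (Fin n) (Fin n) ℝ) (e : Fin n → ℝ) :
    e ⬝ᵥ A.mulVec e = ∑ i, ∑ j, A i j * (e i * e j) := by
  simp only [dotProduct, mulVec, Finset.mul_sum]
  refine Finset.sum_congr rfl fun i _ => Finset.sum_congr rfl fun j _ => by ring

lemma Mom.quad {n : ℕ} {ν : Measure (Fin n → ℝ)} {m : Fin n → ℝ}
    {Q : Matrix (Fin n) (Fin n) ℝ} (H : Mom ν m Q)
    (A : Matrix (Fin n) (Fin n) ℝ) (a : Fin n → ℝ) (c : ℝ) :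
    Integrable (fun e => e ⬝ᵥ A.mulVec e + 2 * (a ⬝ᵥ e) + c) ν ∧
    ∫ e, (e ⬝ᵥ A.mulVec e + 2 * (a ⬝ᵥ e) + c) ∂ν
      = ∑ i, ∑ j, A i j * Q i j + 2 * (a ⬝ᵥ m) + c := by
  have := H.prob
  simp_rw [quad_expand]
  simp only [dotProduct]
  have h1 : Integrable (fun e : Fin n → ℝ => ∑ i, ∑ j, A i j * (e i * e j)) ν :=
    integrable_finsetSum _ fun i _ => integrable_finsetSum _ fun j _ => (H.i2 i j).const_mul _
  have h2 : Integrable (fun e : Fin n → ℝ => 2 * ∑ i, a i * e i) ν :=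
    (integrable_finsetSum _ fun i _ => (H.i1 i).const_mul _).const_mul _
  refine ⟨(h1.add h2).add (integrable_const _), ?_⟩
  rw [integral_add (f := fun e : Fin n → ℝ => ∑ i, ∑ j, A i j * (e i * e j) + 2 * ∑ i, a i * e i)
      (h1.add h2) (integrable_const _), integral_add h1 h2, integral_const_mul,
    integral_finsetSum _ (fun i _ => (H.i1 i).const_mul _)]
  have h3 : ∫ e : Fin n → ℝ, ∑ i, ∑ j, A i j * (e i * e j) ∂ν = ∑ i, ∑ j, A i j * Q i j := by
    refine (integral_finsetSum _ fun i _ =>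
      integrable_finsetSum _ fun j _ => (H.i2 i j).const_mul _).trans ?_
    refine Finset.sum_congr rfl fun i _ => ?_
    refine (integral_finsetSum _ fun j _ => (H.i2 i j).const_mul _).trans ?_
    refine Finset.sum_congr rfl fun j _ => ?_
    rw [integral_const_mul, H.m2]
  rw [h3]
  simp_rw [integral_const_mul, H.m1]
  simp

lemma mem_momentSet_iff {n : ℕ} {S : Matrix (Fin n) (Fin n) ℝ} {μ : Measure (Fin n → ℝ)} :
    μ ∈ momentSet n S ↔ Mom μ 0 S := by
  constructor
  · rintro ⟨hp, hi, h1, h2⟩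
    have i1 : ∀ i, Integrable (fun e : Fin n → ℝ => e i) μ := by
      intro i
      refine ((integrable_const (1:ℝ)).add hi).mono' (measurable_pi_apply i).aestronglyMeasurable (ae_of_all _ fun e => ?_)
      have := norm_le_pi_norm e i
      simp only [Pi.add_apply]
      nlinarith [sq_nonneg (‖e‖ - 1), norm_nonneg e]
    refine ⟨hp, i1, ?_, ?_, h2⟩
    · intro i j
      refine hi.mono' (by fun_prop) (ae_of_all _ fun e => ?_)
      rw [norm_mul, pow_two]
      exact mul_le_mul (norm_le_pi_norm e i) (norm_le_pi_norm e j) (norm_nonneg _) (norm_nonneg _)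
    · intro i
      have := eval_integral (f := fun e : Fin n → ℝ => e) i1 i
      rw [← this, h1]
  · intro H
    have := H.prob
    refine ⟨H.prob, ?_, ?_, H.m2⟩
    · have : Integrable (fun e : Fin n → ℝ => ∑ i, e i * e i) μ :=
        integrable_finsetSum _ fun i _ => H.i2 i i
      refine this.mono' (by fun_prop) (ae_of_all _ fun e => ?_)
      rw [Real.norm_of_nonneg (by positivity)]
      have h0 : 0 ≤ ∑ i, e i * e i := Finset.sum_nonneg fun i _ => mul_self_nonneg _
      have : ‖e‖ ≤ Real.sqrt (∑ i, e i * e i) := by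
        rw [pi_norm_le_iff_of_nonneg (Real.sqrt_nonneg _)]
        intro i
        apply Real.le_sqrt_of_sq_le
        rw [Real.norm_eq_abs, sq_abs, pow_two]
        exact Finset.single_le_sum (f := fun i => e i * e i) (fun i _ => mul_self_nonneg _) (Finset.mem_univ i)
      calc ‖e‖ ^ 2 ≤ Real.sqrt (∑ i, e i * e i) ^ 2 := by gcongr
        _ = _ := Real.sq_sqrt h0
    · ext i
      rw [eval_integral (f := fun e : Fin n → ℝ => e) H.i1 i, H.m1]

lemma exists_mom {n : ℕ} (m : Fin n → ℝ) (C : Matrix (Fin n) (Fin n) ℝ) (hC : C.PosSemidef) :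
    ∃ ν, Mom ν m (Matrix.of fun i j => C i j + m i * m j) := by
  let γ := ProbabilityTheory.multivariateGaussian (WithLp.toLp 2 m) C
  have hm : Measurable (WithLp.ofLp : EuclideanSpace ℝ (Fin n) → (Fin n → ℝ)) := by fun_prop
  have hL : ∀ i, MemLp (fun x : EuclideanSpace ℝ (Fin n) => x i) 2 γ := fun i =>
    (EuclideanSpace.proj (𝕜 := ℝ) i).comp_memLp' ProbabilityTheory.IsGaussian.memLp_two_id
  have i1 : ∀ i, Integrable (fun x : EuclideanSpace ℝ (Fin n) => x i) γ :=
    fun i => (hL i).integrable (by norm_num)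
  have i2 : ∀ i j, Integrable (fun x : EuclideanSpace ℝ (Fin n) => x i * x j) γ :=
    fun i j => (hL i).integrable_mul (hL j)
  have m1 : ∀ i, ∫ x, x i ∂γ = m i := by
    intro i
    have := eval_integral_piLp (q := 2) (f := fun x : EuclideanSpace ℝ (Fin n) => x) i1 i
    rw [← this, ProbabilityTheory.integral_id_multivariateGaussian]
  refine ⟨γ.map WithLp.ofLp, ⟨Measure.isProbabilityMeasure_map hm.aemeasurable, ?_, ?_, ?_, ?_⟩⟩
  · intro i
    rw [integrable_map_measure (measurable_pi_apply i).aestronglyMeasurable hm.aemeasurable]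
    exact i1 i
  · intro i j
    rw [integrable_map_measure (by fun_prop) hm.aemeasurable]
    exact i2 i j
  · intro i
    rw [integral_map hm.aemeasurable (measurable_pi_apply i).aestronglyMeasurable]
    exact m1 i
  · intro i j
    rw [integral_map hm.aemeasurable (by fun_prop)]
    have := ProbabilityTheory.covariance_eval_multivariateGaussian (μ := WithLp.toLp 2 m) hC i j
    rw [ProbabilityTheory.covariance_eq_sub (hL i) (hL j)] at this
    change (∫ x, x i * x j ∂γ) - (∫ x, x i ∂γ) * (∫ x, x j ∂γ) = _ at this
    rw [m1, m1] at this
    change (∫ x : EuclideanSpace ℝ (Fin n), x i * x j ∂γ) = C i j + m i * m j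
    linarith

lemma trust {n : ℕ} (B P : Matrix (Fin n) (Fin n) ℝ) (hP : P.PosSemidef) (q : Fin n → ℝ)
    (k c : ℝ) (hc : 0 < c) :
    ∃ (v : Fin n → ℝ) (l : ℝ), v ⬝ᵥ v ≤ c ^ 2 ∧ 0 ≤ l ∧
      B.mulVec (q - k • P.mulVec (v ᵥ* B)) = l • v ∧ (0 < l → v ⬝ᵥ v = c ^ 2) := by
  let K : Set (Fin n → ℝ) := {v | v ⬝ᵥ v ≤ c ^ 2}
  let f : (Fin n → ℝ) → ℝ := fun v => 2 * (q ⬝ᵥ (v ᵥ* B)) - k * ((v ᵥ* B) ⬝ᵥ P.mulVec (v ᵥ* B))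
  have hf : Continuous f := by fun_prop
  have hK : IsCompact K := by
    refine (isCompact_closedBall (0 : Fin n → ℝ) c).of_isClosed_subset
      (isClosed_le (by fun_prop) (by fun_prop)) fun v hv => ?_
    rw [mem_closedBall_zero_iff, pi_norm_le_iff_of_nonneg hc.le]
    intro i
    have h : v i * v i ≤ v ⬝ᵥ v :=
      Finset.single_le_sum (f := fun i => v i * v i) (fun i _ => mul_self_nonneg _) (Finset.mem_univ i)
    have hv' : v ⬝ᵥ v ≤ c ^ 2 := hv
    exact abs_le_of_sq_le_sq (by nlinarith) hc.le
  obtain ⟨v, hv, hmax⟩ := hK.exists_isMaxOn ⟨0, by simp [K, sq_nonneg]⟩ hf.continuousOn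
  have hv' : v ⬝ᵥ v ≤ c ^ 2 := hv
  set b := v ᵥ* B with hb
  set g := B.mulVec (q - k • P.mulVec b) with hg
  have hsym : ∀ x y, x ⬝ᵥ P.mulVec y = y ⬝ᵥ P.mulVec x := by
    intro x y
    have hPt : Pᵀ = P := hP.isHermitian
    rw [dotProduct_mulVec, ← mulVec_transpose, hPt, dotProduct_comm]
  -- directional derivative
  have hgd : ∀ d, g ⬝ᵥ d = q ⬝ᵥ (d ᵥ* B) - k * (b ⬝ᵥ P.mulVec (d ᵥ* B)) := by
    intro d
    rw [hg, dotProduct_comm, dotProduct_mulVec, dotProduct_sub, dotProduct_smul, dotProduct_comm,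
      hsym, smul_eq_mul]
  have hexp : ∀ (d : Fin n → ℝ) (t : ℝ), f (v + t • d) =
      f v + 2 * t * (g ⬝ᵥ d) - t ^ 2 * (k * ((d ᵥ* B) ⬝ᵥ P.mulVec (d ᵥ* B))) := by
    intro d t
    have := hsym (d ᵥ* B) b
    simp only [f, add_vecMul, smul_vecMul, ← hb, mulVec_add, mulVec_smul, dotProduct_add,
      add_dotProduct, dotProduct_smul, smul_dotProduct, smul_eq_mul, hgd, this]
    ring
  have hopt : ∀ w, w ⬝ᵥ w ≤ c ^ 2 → g ⬝ᵥ (w - v) ≤ 0 := by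
    intro w hw
    by_contra! hpos
    set D := g ⬝ᵥ (w - v) with hD
    set E := k * (((w - v) ᵥ* B) ⬝ᵥ P.mulVec ((w - v) ᵥ* B)) with hE
    have hall : ∀ t : ℝ, 0 ≤ t → t ≤ 1 → 2 * t * D - t ^ 2 * E ≤ 0 := by
      intro t h0 h1
      have hin : v + t • (w - v) ∈ K := by
        change (v + t • (w - v)) ⬝ᵥ (v + t • (w - v)) ≤ c ^ 2
        have e1 : 0 ≤ (w - v) ⬝ᵥ (w - v) := Finset.sum_nonneg fun i _ => mul_self_nonneg _
        simp only [dotProduct_sub, sub_dotProduct, dotProduct_add, add_dotProduct, dotProduct_smul,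
          smul_dotProduct, smul_eq_mul, dotProduct_comm v w] at e1 ⊢
        nlinarith [mul_nonneg (mul_nonneg h0 (sub_nonneg.2 h1)) e1, mul_nonneg h0 (sub_nonneg.2 hw),
          mul_nonneg (sub_nonneg.2 h1) (sub_nonneg.2 hv')]
      have := hmax hin
      simp only [Set.mem_ofPred_eq, hexp, ← hD, ← hE] at this
      linarith
    have h1 := hall (D / (D + |E|)) (by positivity) (by
      rw [div_le_one (by positivity)]; linarith [abs_nonneg E])
    have hDE : 0 < D + |E| := by positivity
    have : 2 * (D / (D + |E|)) * D - (D / (D + |E|)) ^ 2 * E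
        = (D / (D + |E|)) ^ 2 * (2 * D + 2 * |E| - E) := by
      field_simp
    rw [this] at h1
    have h3 : 0 < 2 * D + 2 * |E| - E := by linarith [le_abs_self E, abs_nonneg E]
    have h4 : 0 < (D / (D + |E|)) ^ 2 * (2 * D + 2 * |E| - E) := by positivity
    linarith
  have hgg : 0 ≤ g ⬝ᵥ g := Finset.sum_nonneg fun i _ => mul_self_nonneg _
  rcases hgg.eq_or_lt with h0 | hpos
  · refine ⟨v, 0, hv', le_rfl, ?_, fun h => absurd h (lt_irrefl _)⟩
    rw [zero_smul]
    exact dotProduct_self_eq_zero.1 h0.symm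
  · set G := Real.sqrt (g ⬝ᵥ g) with hG
    have hGp : 0 < G := Real.sqrt_pos.2 hpos
    have hG2 : G ^ 2 = g ⬝ᵥ g := Real.sq_sqrt hgg
    have h1 := hopt ((c / G) • g) (by
      simp only [dotProduct_smul, smul_dotProduct, smul_eq_mul, ← hG2]
      apply le_of_eq; field_simp)
    rw [dotProduct_sub, dotProduct_smul, ← hG2, smul_eq_mul] at h1
    have h1' : c * G ≤ g ⬝ᵥ v := by
      have : c / G * G ^ 2 = c * G := by field_simp
      linarith
    have hz : g - (G / c) • v = 0 := by
      apply dotProduct_self_eq_zero.1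
      refine le_antisymm (a := (g - (G / c) • v) ⬝ᵥ (g - (G / c) • v)) ?_ (Finset.sum_nonneg fun i _ => mul_self_nonneg _)
      simp only [dotProduct_sub, sub_dotProduct, dotProduct_smul,
          smul_dotProduct, smul_eq_mul, dotProduct_comm v g, ← hG2]
      have a1 : G / c * (c * G) ≤ G / c * (g ⬝ᵥ v) := by gcongr
      have a2 : G / c * (G / c * (v ⬝ᵥ v)) ≤ G / c * (G / c * c ^ 2) := by gcongr
      have a3 : G / c * (c * G) = G ^ 2 := by field_simp
      have a4 : G / c * (G / c * c ^ 2) = G ^ 2 := by field_simp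
      linarith
    have hz' : g = (G / c) • v := sub_eq_zero.1 hz
    refine ⟨v, G / c, hv', by positivity, hz', fun _ => ?_⟩
    rw [hz', dotProduct_smul, smul_dotProduct, smul_eq_mul, smul_eq_mul] at hG2
    field_simp at hG2
    linarith

lemma weak_bound {n : ℕ} (P : Matrix (Fin n) (Fin n) ℝ) (q : Fin n → ℝ) (r α : ℝ)
    (hα : α ∈ Set.Ioo (0 : ℝ) 1) (S : Matrix (Fin n) (Fin n) ℝ)
    (μ : Measure (Fin n → ℝ)) (H : Mom μ 0 S) (s : ℝ)
    (M : Matrix (Fin n ⊕ Unit) (Fin n ⊕ Unit) ℝ) (hM : M.PosSemidef)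
    (hMN : (M - Matrix.fromBlocks P (Matrix.of fun i (_ : Unit) => q i)
              (Matrix.of fun (_ : Unit) j => q j)
              (Matrix.of fun (_ : Unit) (_ : Unit) => r - s)).PosSemidef) :
    cvar μ α (fun e => e ⬝ᵥ P.mulVec e + 2 * (q ⬝ᵥ e) + r) ≤ s + α⁻¹ *
            (Matrix.fromBlocks S 0 0 (1 : Matrix Unit Unit ℝ) * M).trace := by
  have hα0 := hα.1
  have := H.prob
  set g : (Fin n → ℝ) → ℝ := fun e => e ⬝ᵥ P.mulVec e + 2 * (q ⬝ᵥ e) + r with hgdef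
  have hgi : Integrable g μ := (H.quad P q r).1
  have hmi : ∀ s, Integrable (fun e => max (g e - s) 0) μ := fun s =>
    (hgi.sub (integrable_const s)).sup (integrable_const 0)
  have hbdd : BddBelow (Set.range fun s : ℝ => s + α⁻¹ * ∫ e, max (g e - s) 0 ∂μ) := by
    refine ⟨∫ e, g e ∂μ, ?_⟩
    rintro _ ⟨s, rfl⟩
    have h1 : ∫ e, (g e - s) ∂μ ≤ ∫ e, max (g e - s) 0 ∂μ :=
      integral_mono (hgi.sub (integrable_const s)) (hmi s) fun e => le_max_left _ _
    rw [integral_sub hgi (integrable_const s)] at h1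
    simp only [integral_const, probReal_univ, one_smul] at h1
    have h2 : 0 ≤ ∫ e, max (g e - s) 0 ∂μ := integral_nonneg fun e => le_max_right _ _
    have h3 : 1 ≤ α⁻¹ := (one_le_inv₀ hα0).2 hα.2.le
    have h4 := mul_le_mul_of_nonneg_right h3 h2
    simp only at *
    linarith
  refine (ciInf_le hbdd s).trans ?_
  gcongr
  let A : Matrix (Fin n) (Fin n) ℝ := Matrix.of fun i j => M (Sum.inl i) (Sum.inl j)
  let a : Fin n → ℝ := fun i => M (Sum.inl i) (Sum.inr ())
  let c : ℝ := M (Sum.inr ()) (Sum.inr ())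
  have hs : ∀ i, M (Sum.inr ()) (Sum.inl i) = M (Sum.inl i) (Sum.inr ()) := fun i => by
    have := hM.isHermitian.apply (Sum.inl i) (Sum.inr ())
    simpa using this
  have hq : ∀ e : Fin n → ℝ, (Sum.elim e fun _ => (1:ℝ)) ⬝ᵥ M.mulVec (Sum.elim e fun _ => (1:ℝ))
      = e ⬝ᵥ A.mulVec e + 2 * (a ⬝ᵥ e) + c := by
    intro e
    simp only [dotProduct, mulVec, Fintype.sum_sum_type, Sum.elim_inl, Sum.elim_inr,
      Finset.univ_unique, Finset.sum_singleton, hs, A, a, c, Matrix.of_apply, mul_add,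
      Finset.sum_add_distrib, PUnit.default_eq_unit]
    have : ∑ i, M (Sum.inl i) (Sum.inr ()) * e i = ∑ i, e i * M (Sum.inl i) (Sum.inr ()) :=
      Finset.sum_congr rfl fun i _ => mul_comm _ _
    simp only [mul_one, one_mul, this]
    ring
  have hN : ∀ e : Fin n → ℝ, (Sum.elim e fun _ => (1:ℝ)) ⬝ᵥ
      (Matrix.fromBlocks P (Matrix.of fun i (_ : Unit) => q i)
              (Matrix.of fun (_ : Unit) j => q j)
              (Matrix.of fun (_ : Unit) (_ : Unit) => r - s)).mulVec (Sum.elim e fun _ => (1:ℝ))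
      = g e - s := by
    intro e
    simp only [dotProduct, mulVec, Fintype.sum_sum_type, Sum.elim_inl, Sum.elim_inr,
      Finset.univ_unique, Finset.sum_singleton, hgdef, Matrix.of_apply, mul_add,
      Finset.sum_add_distrib, PUnit.default_eq_unit, fromBlocks_apply₁₁, fromBlocks_apply₁₂,
      fromBlocks_apply₂₁, fromBlocks_apply₂₂]
    have : ∑ i, e i * q i = ∑ i, q i * e i :=
      Finset.sum_congr rfl fun i _ => mul_comm _ _
    simp only [mul_one, one_mul, this]
    ring
  have hle : ∀ e, max (g e - s) 0 ≤ e ⬝ᵥ A.mulVec e + 2 * (a ⬝ᵥ e) + c := by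
    intro e
    have p1 := hM.dotProduct_mulVec_nonneg (Sum.elim e fun _ => (1:ℝ))
    have p2 := hMN.dotProduct_mulVec_nonneg (Sum.elim e fun _ => (1:ℝ))
    rw [star_trivial] at p1 p2
    rw [sub_mulVec, dotProduct_sub, hN, hq] at p2
    rw [hq] at p1
    exact max_le (by linarith) p1
  have hfin := integral_mono (hmi s) (H.quad A a c).1 hle
  rw [(H.quad A a c).2] at hfin
  refine hfin.trans (le_of_eq ?_)
  simp only [Matrix.trace, Matrix.diag, Matrix.mul_apply, Fintype.sum_sum_type,
      Finset.univ_unique, Finset.sum_singleton, fromBlocks_apply₁₁, fromBlocks_apply₁₂,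
      fromBlocks_apply₂₁, fromBlocks_apply₂₂, Matrix.zero_apply, zero_mul, Finset.sum_const_zero,
      add_zero, zero_add, dotProduct_zero, mul_zero, Matrix.one_apply_eq, one_mul, A, c, Matrix.of_apply,
      PUnit.default_eq_unit]
  congr 1
  rw [Finset.sum_comm]
  refine Finset.sum_congr rfl fun i _ => Finset.sum_congr rfl fun j _ => ?_
  rw [mul_comm]
  congr 1
  exact (H.m2 j i).symm.trans ((by simp_rw [mul_comm] : _ = _).trans (H.m2 i j))

lemma primal_point {n : ℕ} (P : Matrix (Fin n) (Fin n) ℝ) (hP : P.PosSemidef) (q : Fin n → ℝ)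
    (r α : ℝ) (hα : α ∈ Set.Ioo (0 : ℝ) 1) (S : Matrix (Fin n) (Fin n) ℝ)
    (b h : Fin n → ℝ) (hh : h = q - (1 - α)⁻¹ • P.mulVec b) (σ θ : ℝ) (hσ : 0 < σ)
    (hb : h ⬝ᵥ b = (1 - α) * (σ - θ)) :
    ∃ (s : ℝ) (M : Matrix (Fin n ⊕ Unit) (Fin n ⊕ Unit) ℝ),
          M.PosSemidef ∧
          (M - Matrix.fromBlocks P (Matrix.of fun i (_ : Unit) => q i)
              (Matrix.of fun (_ : Unit) j => q j)
              (Matrix.of fun (_ : Unit) (_ : Unit) => r - s)).PosSemidef ∧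
          α * (s + α⁻¹ *
            (Matrix.fromBlocks S 0 0 (1 : Matrix Unit Unit ℝ) * M).trace) =
          ∑ i, ∑ j, P i j * S i j - (1 - α)⁻¹ * (b ⬝ᵥ P.mulVec b) + 2 * (q ⬝ᵥ b) + α * r
          - (1 - α) * θ - h ⬝ᵥ b + σ⁻¹ * (h ⬝ᵥ S.mulVec h + θ ^ 2) := by
  have hα0 := hα.1
  have hα1 : 0 < 1 - α := sub_pos.2 hα.2
  have hPt : Pᵀ = P := hP.isHermitian
  have hsym : ∀ x y, x ⬝ᵥ P.mulVec y = y ⬝ᵥ P.mulVec x := by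
    intro x y
    rw [dotProduct_mulVec, ← mulVec_transpose, hPt, dotProduct_comm]
  set k := (1 - α)⁻¹ with hk
  have hk1 : (1 - α) * k = 1 := mul_inv_cancel₀ hα1.ne'
  let s := r + θ - k * (q ⬝ᵥ b)
  let ζ : Fin n ⊕ Unit → ℝ := Sum.elim h fun _ => -θ
  let N : Matrix (Fin n ⊕ Unit) (Fin n ⊕ Unit) ℝ :=
    Matrix.fromBlocks P (Matrix.of fun i (_ : Unit) => q i)
              (Matrix.of fun (_ : Unit) j => q j)
              (Matrix.of fun (_ : Unit) (_ : Unit) => r - s)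
  let Z : Matrix (Fin n ⊕ Unit) (Fin n ⊕ Unit) ℝ := σ⁻¹ • vecMulVec ζ ζ
  have hZ : Z.PosSemidef := by
    have := posSemidef_vecMulVec_self_star ζ
    rw [star_trivial] at this
    exact this.smul (inv_nonneg.2 hσ.le)
  have hNh : N.IsHermitian := by
    rw [Matrix.isHermitian_fromBlocks_iff]
    refine ⟨hP.isHermitian, ?_, ?_, ?_⟩ <;> ext <;> simp
  refine ⟨s, N + Z, ?_, ?_, ?_⟩
  · refine Matrix.PosSemidef.of_dotProduct_mulVec_nonneg (hNh.add hZ.isHermitian) fun x => ?_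
    rw [star_trivial]
    let e : Fin n → ℝ := fun i => x (Sum.inl i)
    let t : ℝ := x (Sum.inr ())
    have hx : x = Sum.elim e fun _ => t := by
      ext (i | i) <;> simp [e, t]
    have h1 : x ⬝ᵥ N.mulVec x = e ⬝ᵥ P.mulVec e + 2 * t * (q ⬝ᵥ e) + t ^ 2 * (r - s) := by
      rw [hx]
      simp only [dotProduct, mulVec, Fintype.sum_sum_type, Sum.elim_inl, Sum.elim_inr,
        Finset.univ_unique, Finset.sum_singleton, Matrix.of_apply, mul_add, N,
        Finset.sum_add_distrib, PUnit.default_eq_unit, fromBlocks_apply₁₁, fromBlocks_apply₁₂,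
        fromBlocks_apply₂₁, fromBlocks_apply₂₂]
      have : ∑ i, e i * (q i * t) = t * ∑ i, q i * e i := by
        rw [Finset.mul_sum]
        exact Finset.sum_congr rfl fun i _ => by ring
      rw [this]
      ring
    have h2 : x ⬝ᵥ Z.mulVec x = σ⁻¹ * (h ⬝ᵥ e - θ * t) ^ 2 := by
      have : ζ ⬝ᵥ x = h ⬝ᵥ e - θ * t := by
        rw [hx]
        simp [dotProduct, ζ, sub_eq_add_neg]
      simp only [Z, smul_mulVec, vecMulVec_mulVec, dotProduct_smul, this, dotProduct_comm x ζ,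
        smul_eq_mul, op_smul_eq_smul]
      ring
    have h3 := hP.dotProduct_mulVec_nonneg (e + (t * k) • b)
    rw [star_trivial] at h3
    simp only [mulVec_add, mulVec_smul, dotProduct_add, add_dotProduct, dotProduct_smul,
      smul_dotProduct, smul_eq_mul, hsym b e] at h3
    have h4 : h ⬝ᵥ e = q ⬝ᵥ e - k * (e ⬝ᵥ P.mulVec b) := by
      rw [hh, sub_dotProduct, smul_dotProduct, dotProduct_comm (P.mulVec b), smul_eq_mul]
    have h5 : h ⬝ᵥ b = q ⬝ᵥ b - k * (b ⬝ᵥ P.mulVec b) := by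
      rw [hh, sub_dotProduct, smul_dotProduct, dotProduct_comm (P.mulVec b), smul_eq_mul]
    have h6 : k * (q ⬝ᵥ b) - k * (k * (b ⬝ᵥ P.mulVec b)) = σ - θ := by
      rw [hb] at h5
      linear_combination (-k) * h5 + (σ - θ) * hk1
    have h7 : 0 ≤ σ⁻¹ * (h ⬝ᵥ e + t * (σ - θ)) ^ 2 := by positivity
    have h8 : σ⁻¹ * (h ⬝ᵥ e + t * (σ - θ)) ^ 2 = σ⁻¹ * (h ⬝ᵥ e - θ * t) ^ 2
        + 2 * t * (h ⬝ᵥ e - θ * t) + t ^ 2 * σ := by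
      field_simp
      ring
    rw [add_mulVec, dotProduct_add, h1, h2]
    have h9 := congrArg (fun z => t ^ 2 * z) h6
    rw [h8] at h7
    have h10 : t * (h ⬝ᵥ e) = t * (q ⬝ᵥ e) - t * (k * (e ⬝ᵥ P.mulVec b)) := by
      rw [h4]; ring
    simp only [s]
    nlinarith [h3, h7, h9, h10]
  · change (N + Z - N).PosSemidef
    rw [add_sub_cancel_left]
    exact hZ
  · have htr : (Matrix.fromBlocks S 0 0 (1 : Matrix Unit Unit ℝ) * (N + Z)).trace =
        ∑ i, ∑ j, P i j * S i j + (r - s) + σ⁻¹ * (h ⬝ᵥ S.mulVec h + θ ^ 2) := by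
      rw [quad_expand]
      simp only [Matrix.trace, Matrix.diag, Matrix.mul_apply, Fintype.sum_sum_type,
        Finset.univ_unique, Finset.sum_singleton, fromBlocks_apply₁₁, fromBlocks_apply₁₂,
        fromBlocks_apply₂₁, fromBlocks_apply₂₂, Matrix.zero_apply, zero_mul, Finset.sum_const_zero,
        add_zero, zero_add, Matrix.one_apply_eq, one_mul, N, Z, ζ, Matrix.of_apply,
        PUnit.default_eq_unit, Matrix.add_apply, Matrix.smul_apply, vecMulVec_apply, Sum.elim_inl,
        Sum.elim_inr, smul_eq_mul, mul_add, Finset.sum_add_distrib]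
      have e1 : ∑ i, ∑ j, S i j * P j i = ∑ i, ∑ j, P i j * S i j := by
        refine Finset.sum_congr rfl fun i _ => Finset.sum_congr rfl fun j _ => ?_
        have : P j i = P i j := congrFun (congrFun hPt i) j
        rw [this, mul_comm]
      have e2 : ∑ i, ∑ j, S i j * (σ⁻¹ * (h j * h i)) = σ⁻¹ * ∑ i, ∑ j, S i j * (h i * h j) := by
        simp_rw [Finset.mul_sum]
        refine Finset.sum_congr rfl fun i _ => Finset.sum_congr rfl fun j _ => by ring
      rw [e1, e2]
      ring
    rw [htr, mul_add, mul_inv_cancel_left₀ hα0.ne']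
    have h5 : h ⬝ᵥ b = q ⬝ᵥ b - k * (b ⬝ᵥ P.mulVec b) := by
      rw [hh, sub_dotProduct, smul_dotProduct, dotProduct_comm (P.mulVec b), smul_eq_mul]
    simp only [s]
    linear_combination h5 + (q ⬝ᵥ b) * hk1

lemma dual_point {n : ℕ} (P : Matrix (Fin n) (Fin n) ℝ) (q : Fin n → ℝ)
    (r α : ℝ) (hα : α ∈ Set.Ioo (0 : ℝ) 1) (B S : Matrix (Fin n) (Fin n) ℝ)
    (hS : S.PosSemidef) (hB : S = Bᵀ * B) (v b : Fin n → ℝ)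
    (hv : v ⬝ᵥ v ≤ α * (1 - α)) (hb : b = v ᵥ* B) :
    ∃ μ, Mom μ 0 S ∧
      ∑ i, ∑ j, P i j * S i j - (1 - α)⁻¹ * (b ⬝ᵥ P.mulVec b) + 2 * (q ⬝ᵥ b) + α * r ≤
      α * cvar μ α (fun e => e ⬝ᵥ P.mulVec e + 2 * (q ⬝ᵥ e) + r) := by
  have hα0 := hα.1
  have hα1 : 0 < 1 - α := sub_pos.2 hα.2
  let C : Matrix (Fin n) (Fin n) ℝ := α⁻¹ • (S - (α * (1 - α))⁻¹ • vecMulVec b b)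
  have hC : C.PosSemidef := by
    refine Matrix.PosSemidef.smul ?_ (inv_nonneg.2 hα0.le)
    have hv1 := posSemidef_vecMulVec_self_star b
    rw [star_trivial] at hv1
    refine Matrix.PosSemidef.of_dotProduct_mulVec_nonneg
      (hS.isHermitian.sub (hv1.smul (by positivity : 0 ≤ (α * (1 - α))⁻¹)).isHermitian) fun x => ?_
    have h1 : x ⬝ᵥ S.mulVec x = B.mulVec x ⬝ᵥ B.mulVec x := by
      rw [hB, ← mulVec_mulVec, dotProduct_mulVec, vecMul_transpose]
    have h2 : b ⬝ᵥ x = v ⬝ᵥ B.mulVec x := by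
      rw [hb, dotProduct_mulVec]
    have h3 : (v ⬝ᵥ B.mulVec x) ^ 2 ≤ (v ⬝ᵥ v) * (B.mulVec x ⬝ᵥ B.mulVec x) := by
      have := Finset.sum_mul_sq_le_sq_mul_sq Finset.univ v (B.mulVec x)
      simpa only [dotProduct, pow_two] using this
    have h4 : 0 ≤ B.mulVec x ⬝ᵥ B.mulVec x := Finset.sum_nonneg fun i _ => mul_self_nonneg _
    rw [star_trivial, sub_mulVec, dotProduct_sub, h1]
    simp only [smul_mulVec, vecMulVec_mulVec, dotProduct_smul, dotProduct_comm x b,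
        smul_eq_mul, op_smul_eq_smul, h2]
    have h5 : v ⬝ᵥ B.mulVec x * v ⬝ᵥ B.mulVec x ≤ α * (1 - α) * (B.mulVec x ⬝ᵥ B.mulVec x) := by
      rw [← pow_two]
      exact h3.trans (mul_le_mul_of_nonneg_right hv h4)
    rw [sub_nonneg, inv_mul_le_iff₀ (by positivity)]
    exact h5
  obtain ⟨ν, hν⟩ := exists_mom (α⁻¹ • b) C hC
  have := hν.prob
  let p : Fin n → ℝ := -((1 - α)⁻¹ • b)
  let μ : Measure (Fin n → ℝ) := ENNReal.ofReal α • ν + ENNReal.ofReal (1 - α) • Measure.dirac p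
  have hint : ∀ f : (Fin n → ℝ) → ℝ, Integrable f ν → Integrable f μ := by
    intro f hf
    exact (hf.smul_measure ENNReal.ofReal_ne_top).add_measure
      ((integrable_dirac (by simp)).smul_measure ENNReal.ofReal_ne_top)
  have hval : ∀ f : (Fin n → ℝ) → ℝ, Integrable f ν →
      ∫ e, f e ∂μ = α * ∫ e, f e ∂ν + (1 - α) * f p := by
    intro f hf
    rw [integral_add_measure (hf.smul_measure ENNReal.ofReal_ne_top)
      ((integrable_dirac (by simp)).smul_measure ENNReal.ofReal_ne_top),
      integral_smul_measure, integral_smul_measure, integral_dirac,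
      ENNReal.toReal_ofReal hα0.le, ENNReal.toReal_ofReal hα1.le, smul_eq_mul, smul_eq_mul]
  have hμ : Mom μ 0 S := by
    refine ⟨⟨?_⟩, fun i => hint _ (hν.i1 i), fun i j => hint _ (hν.i2 i j), fun i => ?_, fun i j => ?_⟩
    · simp only [μ, Measure.add_apply, Measure.smul_apply, measure_univ, smul_eq_mul, mul_one]
      rw [← ENNReal.ofReal_add hα0.le hα1.le]
      simp
    · rw [hval _ (hν.i1 i), hν.m1]
      simp only [p, Pi.smul_apply, Pi.neg_apply, smul_eq_mul, Pi.zero_apply]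
      field_simp
      ring
    · rw [hval _ (hν.i2 i j), hν.m2]
      simp only [p, Pi.smul_apply, Pi.neg_apply, smul_eq_mul, C, Matrix.of_apply, Matrix.smul_apply,
        Matrix.sub_apply, vecMulVec_apply]
      field_simp
      ring
  refine ⟨μ, hμ, ?_⟩
  have := hμ.prob
  obtain ⟨hgi, hgv⟩ := hν.quad P q r
  set g : (Fin n → ℝ) → ℝ := fun e => e ⬝ᵥ P.mulVec e + 2 * (q ⬝ᵥ e) + r with hgdef
  have hkey : ∫ e, g e ∂ν ≤ cvar μ α g := by
    refine le_ciInf fun s => ?_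
    have hmi : Integrable (fun e => max (g e - s) 0) ν :=
      (hgi.sub (integrable_const s)).sup (integrable_const 0)
    rw [hval _ hmi]
    have h1 : ∫ e, (g e - s) ∂ν ≤ ∫ e, max (g e - s) 0 ∂ν :=
      integral_mono (hgi.sub (integrable_const s)) hmi fun e => le_max_left _ _
    rw [integral_sub hgi (integrable_const s)] at h1
    simp only [integral_const, probReal_univ, one_smul] at h1
    rw [mul_add, inv_mul_cancel_left₀ hα0.ne']
    have h2 : 0 ≤ α⁻¹ * ((1 - α) * max (g p - s) 0) := by positivity
    linarith
  refine le_trans (le_of_eq ?_) (mul_le_mul_of_nonneg_left hkey hα0.le)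
  refine Eq.trans ?_ (congrArg (fun z => α * z) hgv).symm
  simp only [C, Matrix.of_apply, Matrix.smul_apply,
        Matrix.sub_apply, vecMulVec_apply, Pi.smul_apply, smul_eq_mul, dotProduct_smul]
  have e1 : ∑ i, ∑ j, P i j * (α⁻¹ * (S i j - (α * (1 - α))⁻¹ * (b i * b j)) + α⁻¹ * b i * (α⁻¹ * b j))
      = α⁻¹ * (∑ i, ∑ j, P i j * S i j - (1 - α)⁻¹ * (b ⬝ᵥ P.mulVec b)) := by
    rw [quad_expand]
    simp only [Finset.mul_sum, ← Finset.sum_sub_distrib]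
    refine Finset.sum_congr rfl fun i _ => Finset.sum_congr rfl fun j _ => ?_
    field_simp
    ring
  rw [e1]
  field_simp

open scoped MatrixOrder in
lemma psd_factor {n : ℕ} {S : Matrix (Fin n) (Fin n) ℝ} (hS : S.PosSemidef) :
    ∃ B : Matrix (Fin n) (Fin n) ℝ, S = Bᵀ * B := by
  obtain ⟨X, hX, -, h⟩ :=
    CFC.exists_sqrt_of_isSelfAdjoint_of_quasispectrumRestricts hS.isHermitian
      (QuasispectrumRestricts.nnreal_of_nonneg hS.nonneg)
  have hXt : Xᵀ = X := hX.star_eq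
  exact ⟨X, by rw [hXt, h]⟩

/-- Exact SDP reformulation (Zymler et al.) of the worst-case CVaR of the
quadratic function `g(e) = eᵀ P e + 2 qᵀ e + r` over the moment-based
ambiguity set with zero mean and second moment matrix `S`:
it equals the infimum of `s + α⁻¹ Tr(Ω M)` over `s ∈ ℝ` and positive
semidefinite `M` with `M − [[P, q],[qᵀ, r − s]] ⪰ 0`, where
`Ω = [[S, 0],[0, 1]]`. -/
theorem worst_case_cvar_sdp_reformulation
    (n : ℕ) (P : Matrix (Fin n) (Fin n) ℝ) (hP : P.PosSemidef)
    (q : Fin n → ℝ) (r : ℝ) (α : ℝ) (hα : α ∈ Set.Ioo (0 : ℝ) 1)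
    (S : Matrix (Fin n) (Fin n) ℝ) (hS : S.PosSemidef) :
    (⨆ μ : momentSet n S,
        cvar μ.1 α (fun e => e ⬝ᵥ P.mulVec e + 2 * (q ⬝ᵥ e) + r))
      = sInf {t : ℝ | ∃ (s : ℝ) (M : Matrix (Fin n ⊕ Unit) (Fin n ⊕ Unit) ℝ),
          M.PosSemidef ∧
          (M - Matrix.fromBlocks P (Matrix.of fun i (_ : Unit) => q i)
              (Matrix.of fun (_ : Unit) j => q j)
              (Matrix.of fun (_ : Unit) (_ : Unit) => r - s)).PosSemidef ∧
          t = s + α⁻¹ *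
            (Matrix.fromBlocks S 0 0 (1 : Matrix Unit Unit ℝ) * M).trace} := by
  have hα0 := hα.1
  have hα1 : 0 < 1 - α := sub_pos.2 hα.2
  obtain ⟨B, hB⟩ := psd_factor hS
  have hcc : (Real.sqrt (α * (1 - α))) ^ 2 = α * (1 - α) := Real.sq_sqrt (by positivity)
  obtain ⟨v, l, hv, hl, hBl, hvl⟩ := trust B P hP q (1 - α)⁻¹ (Real.sqrt (α * (1 - α)))
    (Real.sqrt_pos.2 (by positivity))
  rw [hcc] at hv hvl
  set b := v ᵥ* B with hb
  set h := q - (1 - α)⁻¹ • P.mulVec b with hh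
  obtain ⟨μ, hμ, hval⟩ := dual_point P q r α hα B S hS hB v b hv hb
  have hSh : h ⬝ᵥ S.mulVec h = l ^ 2 * (v ⬝ᵥ v) := by
    rw [hB, ← mulVec_mulVec, dotProduct_mulVec, vecMul_transpose, hBl, smul_dotProduct,
      dotProduct_smul, smul_eq_mul, smul_eq_mul]
    ring
  have hhb : h ⬝ᵥ b = l * (v ⬝ᵥ v) := by
    rw [hb, dotProduct_comm, ← dotProduct_mulVec, hBl, dotProduct_smul, smul_eq_mul]
  set T : Set ℝ := {t : ℝ | ∃ (s : ℝ) (M : Matrix (Fin n ⊕ Unit) (Fin n ⊕ Unit) ℝ),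
          M.PosSemidef ∧
          (M - Matrix.fromBlocks P (Matrix.of fun i (_ : Unit) => q i)
              (Matrix.of fun (_ : Unit) j => q j)
              (Matrix.of fun (_ : Unit) (_ : Unit) => r - s)).PosSemidef ∧
          t = s + α⁻¹ *
            (Matrix.fromBlocks S 0 0 (1 : Matrix Unit Unit ℝ) * M).trace} with hT
  set g : (Fin n → ℝ) → ℝ := fun e => e ⬝ᵥ P.mulVec e + 2 * (q ⬝ᵥ e) + r with hg
  have hweak : ∀ μ : momentSet n S, ∀ t ∈ T, cvar μ.1 α g ≤ t := by
    rintro μ _ ⟨s, M, hM, hMN, rfl⟩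
    exact weak_bound P q r α hα S μ.1 (mem_momentSet_iff.1 μ.2) s M hM hMN
  have hstrong : ∀ ε : ℝ, 0 < ε → ∃ t ∈ T, t ≤ cvar μ α g + ε := by
    intro ε hε
    have hex : ∃ σ θ : ℝ, 0 < σ ∧ h ⬝ᵥ b = (1 - α) * (σ - θ) ∧
        - (1 - α) * θ - h ⬝ᵥ b + σ⁻¹ * (h ⬝ᵥ S.mulVec h + θ ^ 2) ≤ α * ε := by
      rcases hl.eq_or_lt with h0 | hpos
      · refine ⟨ε, ε, hε, ?_, ?_⟩
        · rw [hhb, ← h0]; ring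
        · rw [hhb, hSh, ← h0]
          apply le_of_eq
          field_simp
          ring
      · have hvv := hvl hpos
        refine ⟨l, l * (1 - α), hpos, ?_, ?_⟩
        · rw [hhb, hvv]; ring
        · rw [hhb, hSh, hvv]
          refine le_trans (le_of_eq ?_) (by positivity : 0 ≤ α * ε)
          field_simp
          ring
    obtain ⟨σ, θ, hσ, h1, h2⟩ := hex
    obtain ⟨s, M, hM, hMN, hv⟩ := primal_point P hP q r α hα S b h hh σ θ hσ h1
    refine ⟨_, ⟨s, M, hM, hMN, rfl⟩, ?_⟩
    refine le_of_mul_le_mul_left ?_ hα0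
    rw [hv, mul_add]
    linarith
  let μ' : momentSet n S := ⟨μ, mem_momentSet_iff.2 hμ⟩
  obtain ⟨t0, ht0, -⟩ := hstrong 1 one_pos
  have hne : Nonempty (momentSet n S) := ⟨μ'⟩
  apply le_antisymm
  · exact ciSup_le fun μ => le_csInf ⟨t0, ht0⟩ fun t ht => hweak μ t ht
  · refine le_of_forall_pos_le_add fun ε hε => ?_
    obtain ⟨t, ht, hle⟩ := hstrong ε hε
    have hbb : BddBelow T := ⟨_, fun t ht => hweak μ' t ht⟩
    have hba : BddAbove (Set.range fun μ : momentSet n S => cvar μ.1 α g) := by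
      refine ⟨t0, ?_⟩
      rintro _ ⟨μ, rfl⟩
      exact hweak μ t0 ht0
    have := le_ciSup hba μ'
    exact (csInf_le hbb ht).trans (hle.trans (by gcongr))
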